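/- Let u ∈ k^* and let α ∈ Aff_3(k) \ B have type (γ1,γ2,γ3). If either (γ1,γ3) = (3,3) and γ2 ≤ 2, or (γ1,γ3) ≠ (3,3) and γ2 = 3, then the lift α̂ of α satisfies condition (C). -/

import Mathlib

open MvPolynomial

noncomputable section

namespace YasudaPaper

variable {k : Type*} [Field k]

/-- `f := x1*x3 - x2^2` (variables: `X 0 = x1, X 1 = x2, X 2 = x3`). -/
def fP : MvPolynomial (Fin 3) k := X 0 * X 2 - X 1 ^ 2

/-- `r := x2*f + x1^2`. -/
def rP : MvPolynomial (Fin 3) k := X 1 * fP + X 0 ^ 2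

/-- `g := x3*f^2 + 2*x1*x2*f + x1^3`. -/
def gP : MvPolynomial (Fin 3) k := X 2 * fP ^ 2 + 2 * X 0 * X 1 * fP + X 0 ^ 3

/-- The Jacobian derivation `Δ = Δ_{(f,g)}`, `h ↦ det ∂(f,g,h)/∂(x1,x2,x3)`. -/
def Del (h : MvPolynomial (Fin 3) k) : MvPolynomial (Fin 3) k :=
  Matrix.det !![pderiv 0 fP, pderiv 1 fP, pderiv 2 fP;
                pderiv 0 gP, pderiv 1 gP, pderiv 2 gP;
                pderiv 0 h,  pderiv 1 h,  pderiv 2 h]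

/-- `φ = exp D`: for every `h` and every `N` with `D^[N] h = 0`,
    `φ h = ∑_{i<N} D^i(h)/i!`.  (For a locally nilpotent `D` this characterizes
    the exponential automorphism.) -/
def IsExpOf {σ : Type*} (D : MvPolynomial σ k → MvPolynomial σ k)
    (φ : MvPolynomial σ k ≃ₐ[k] MvPolynomial σ k) : Prop :=
  ∀ (h : MvPolynomial σ k) (N : ℕ), D^[N] h = 0 →
    φ h = ∑ i ∈ Finset.range N, (Nat.factorial i : k)⁻¹ • D^[i] h

/-- `α` is an affine automorphism: `α(x_i) = ∑_j a_{j,i} x_j + b_i` with `A ∈ GL₃(k)`. -/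
def IsAffine (α : MvPolynomial (Fin 3) k ≃ₐ[k] MvPolynomial (Fin 3) k) : Prop :=
  ∃ (A : Matrix (Fin 3) (Fin 3) k) (b : Fin 3 → k), IsUnit A.det ∧
    ∀ i : Fin 3, α (X i) = (∑ j : Fin 3, C (A j i) * X j) + C (b i)

/-- `Aff_3(k)` as a set of automorphisms. -/
def AffSet : Set (MvPolynomial (Fin 3) k ≃ₐ[k] MvPolynomial (Fin 3) k) := {α | IsAffine α}

/-- `α` is a triangular automorphism: `α(x_i) = a_i x_i + f_i(x_1,…,x_{i-1})`, `a_i ≠ 0`. -/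
def IsTriangular (α : MvPolynomial (Fin 3) k ≃ₐ[k] MvPolynomial (Fin 3) k) : Prop :=
  ∃ (a : Fin 3 → k) (p : Fin 3 → MvPolynomial (Fin 3) k),
    (∀ i, a i ≠ 0) ∧ (∀ i, p i ∈ MvPolynomial.supported k {j | j < i}) ∧
    (∀ i, α (X i) = C (a i) * X i + p i)

/-- `BA_3(k)` as a set of automorphisms. -/
def TriSet : Set (MvPolynomial (Fin 3) k ≃ₐ[k] MvPolynomial (Fin 3) k) := {α | IsTriangular α}

/-- The tame subgroup `TA_3(k) = ⟨Aff_3(k), BA_3(k)⟩`. -/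
def TA : Subgroup (MvPolynomial (Fin 3) k ≃ₐ[k] MvPolynomial (Fin 3) k) :=
  Subgroup.closure (AffSet ∪ TriSet)

/-- `β = β_u = (u^3 x1, u^2 x2, u x3)`. -/
def IsBeta (u : k) (β : MvPolynomial (Fin 3) k ≃ₐ[k] MvPolynomial (Fin 3) k) : Prop :=
  β (X 0) = C (u ^ 3) * X 0 ∧ β (X 1) = C (u ^ 2) * X 1 ∧ β (X 2) = C u * X 2

/-- `B = {β_u | u ∈ k^*}`. -/
def BSet : Set (MvPolynomial (Fin 3) k ≃ₐ[k] MvPolynomial (Fin 3) k) :=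
  {β | ∃ u : k, u ≠ 0 ∧ IsBeta u β}

/-! Six-variable ring `k[x1,x2,x3,t_r,t_f,t_g]`:
variables `X 0 = x1, X 1 = x2, X 2 = x3, X 3 = t_r, X 4 = t_f, X 5 = t_g`. -/

/-- The inclusion of variable index sets. -/
def ι36 : Fin 3 → Fin 6 := Fin.castLE (by norm_num)

/-- The embedding `k[x1,x2,x3] → k[x1,x2,x3,t_r,t_f,t_g]`. -/
def embP : MvPolynomial (Fin 3) k →ₐ[k] MvPolynomial (Fin 6) k := rename ι36

/-- The substitution map `π : t_r ↦ r, t_f ↦ f, t_g ↦ g` (fixing `x1,x2,x3`). -/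
def piMap : MvPolynomial (Fin 6) k →ₐ[k] MvPolynomial (Fin 3) k :=
  aeval ![X 0, X 1, X 2, rP, fP, gP]

/-- The triangular derivation
`Δ' = -2 t_r t_f ∂/∂x1 + (4 x1 t_r - t_g) ∂/∂x2 + (6 x2 t_r + 2 t_f²) ∂/∂x3 - t_f t_g ∂/∂t_r`. -/
def Del' (p : MvPolynomial (Fin 6) k) : MvPolynomial (Fin 6) k :=
  (-(2 * X 3 * X 4)) * pderiv 0 p + (4 * X 0 * X 3 - X 5) * pderiv 1 p +
  (6 * X 1 * X 3 + 2 * X 4 ^ 2) * pderiv 2 p + (-(X 4 * X 5)) * pderiv 3 p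

/-- The weight `w1 = (1,2,3,1,0,1)`. -/
def w1 : Fin 6 → ℕ := ![1, 2, 3, 1, 0, 1]

/-- The weight `w2 = (0,0,0,0,1,0)`. -/
def w2 : Fin 6 → ℕ := ![0, 0, 0, 0, 1, 0]

/-- The sixth cyclic lexicographic order on exponent vectors: first compare the
exponent of `t_g`, then lexicographically the exponents of `x1,x2,x3,t_r,t_f`. -/
def cyclicLt (a b : Fin 6 →₀ ℕ) : Prop :=
  a 5 < b 5 ∨ (a 5 = b 5 ∧ ∃ m : Fin 5,
    (∀ l : Fin 5, l < m → a l.castSucc = b l.castSucc) ∧ a m.castSucc < b m.castSucc)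

/-- The leading monomial of `p` (for the sixth cyclic lexicographic order) is `m`. -/
def LeadMonIs (p : MvPolynomial (Fin 6) k) (m : Fin 6 →₀ ℕ) : Prop :=
  m ∈ p.support ∧ ∀ m' ∈ p.support, m' ≠ m → cyclicLt m' m

/-- The exponent vector of the monomial `t_f^δ t_g^γ`. -/
def tfMon (γ δ : ℕ) : Fin 6 →₀ ℕ := Finsupp.single 4 δ + Finsupp.single 5 γ

/-- The set `P_{γ,δ}`. -/
def Pset (γ δ : ℕ) : Set (MvPolynomial (Fin 6) k) :=
  {p | p ≠ 0 ∧ weightedTotalDegree w1 p ≤ γ ∧ weightedTotalDegree w2 p ≤ δ ∧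
    LeadMonIs p (tfMon γ δ)}

/-- `α'` is a lift of `α`. -/
def IsLift (α : MvPolynomial (Fin 3) k ≃ₐ[k] MvPolynomial (Fin 3) k)
    (α' : MvPolynomial (Fin 6) k →ₐ[k] MvPolynomial (Fin 6) k) : Prop :=
  (∀ i : Fin 3, α' (X (ι36 i)) = embP (α (X i))) ∧
  (∀ p, piMap (α' p) = α (piMap p))

/-- `t = γ_j = max {i | a_{i,j} ≠ 0}` (with rows indexed `1,2,3`). -/
def TypeIs (A : Matrix (Fin 3) (Fin 3) k) (j : Fin 3) (t : ℕ) : Prop :=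
  ∃ i : Fin 3, t = (i : ℕ) + 1 ∧ A i j ≠ 0 ∧ ∀ i' : Fin 3, i < i' → A i' j = 0

/-- Condition (C) for a lift `α'` of an affine automorphism of type `(γ1,γ2,γ3)`,
relative to `φ' = exp(uΔ')`. -/
def CondC (γ1 γ2 γ3 : ℕ) (φ' : MvPolynomial (Fin 6) k ≃ₐ[k] MvPolynomial (Fin 6) k)
    (α' : MvPolynomial (Fin 6) k →ₐ[k] MvPolynomial (Fin 6) k) : Prop :=
  ∃ m4 m5 m6 n4 n5 n6 : ℕ,
    1 ≤ n4 ∧ 1 ≤ n5 ∧ 1 ≤ n6 ∧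
    φ' (α' (X 3)) ∈ Pset m4 n4 ∧
    φ' (α' (X 4)) ∈ Pset m5 n5 ∧
    φ' (α' (X 5)) ∈ Pset m6 n6 ∧
    γ1 ≤ m6 ∧ γ2 ≤ 2 * m6 ∧ γ3 ≤ 3 * m6 ∧ m4 ≤ m6 ∧
    γ1 + 1 ≤ n6 - 1 ∧ γ2 + 1 ≤ 2 * (n6 - 1) ∧ γ3 + 1 ≤ 3 * (n6 - 1) ∧ n4 ≤ n6 - 1

/-- The image of `x_j` under the affine map given by `(A, d)`, inside the six-variable ring. -/
def affImg (A : Matrix (Fin 3) (Fin 3) k) (d : Fin 3 → k) (j : Fin 3) :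
    MvPolynomial (Fin 6) k :=
  (∑ i : Fin 3, C (A i j) * X (ι36 i)) + C (d j)

/-- The image of `t_f` under the lift `α̂`:
`α̂(t_f) = α(f) + (a_{1,1}a_{3,3} - 2a_{1,2}a_{3,2} + a_{1,3}a_{3,1})(t_f - f)`. -/
def hatTf (A : Matrix (Fin 3) (Fin 3) k) (d : Fin 3 → k) : MvPolynomial (Fin 6) k :=
  (affImg A d 0 * affImg A d 2 - affImg A d 1 ^ 2) +
    C (A 0 0 * A 2 2 - 2 * (A 0 1 * A 2 1) + A 0 2 * A 2 0) *
      (X 4 - (X 0 * X 2 - X 1 ^ 2))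

/-- The lift `α̂` of the affine automorphism given by `(A, d)`:
`α̂(x_i) = α(x_i)`, `α̂(t_f)` as in `hatTf`, `α̂(t_r) = α̂(x2 t_f + x1²)`,
`α̂(t_g) = α̂(x3 t_f² + 2 x1 x2 t_f + x1³)`. -/
def hatLift (A : Matrix (Fin 3) (Fin 3) k) (d : Fin 3 → k) :
    MvPolynomial (Fin 6) k →ₐ[k] MvPolynomial (Fin 6) k :=
  aeval ![affImg A d 0, affImg A d 1, affImg A d 2,
    affImg A d 1 * hatTf A d + affImg A d 0 ^ 2,
    hatTf A d,
    affImg A d 2 * hatTf A d ^ 2 + 2 * affImg A d 0 * affImg A d 1 * hatTf A d +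
      affImg A d 0 ^ 3]

/-- The exponents of `p` lie in the box `{w1 ≤ γ, w2 ≤ δ}`, and the coefficient of `p` at the
extreme monomial `t_f^δ t_g^γ` of that box is `c`. -/
def HasCorner (γ δ : ℕ) (c : k) (p : MvPolynomial (Fin 6) k) : Prop :=
  (∀ m ∈ p.support, Finsupp.weight w1 m ≤ γ ∧ Finsupp.weight w2 m ≤ δ) ∧
    coeff (tfMon γ δ) p = c

theorem weight_w1_apply (m : Fin 6 →₀ ℕ) :
    Finsupp.weight w1 m = m 0 + 2 * m 1 + 3 * m 2 + m 3 + m 5 := by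
  simp [Finsupp.weight_apply, Finsupp.sum_fintype, Fin.sum_univ_six, w1]
  ring

theorem weight_w2_apply (m : Fin 6 →₀ ℕ) : Finsupp.weight w2 m = m 4 := by
  simp [Finsupp.weight_apply, Finsupp.sum_fintype, Fin.sum_univ_six, w2]

theorem eq_tfMon_iff {m : Fin 6 →₀ ℕ} {γ δ : ℕ} :
    m = tfMon γ δ ↔ m 0 = 0 ∧ m 1 = 0 ∧ m 2 = 0 ∧ m 3 = 0 ∧ m 4 = δ ∧ m 5 = γ := by
  constructor
  · rintro rfl
    simp [tfMon]
  · rintro ⟨h0, h1, h2, h3, h4, h5⟩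
    ext i
    fin_cases i <;> simp_all [tfMon]

theorem weight_w1_tfMon (γ δ : ℕ) : Finsupp.weight w1 (tfMon γ δ) = γ := by
  simp [weight_w1_apply, tfMon]

theorem weight_w2_tfMon (γ δ : ℕ) : Finsupp.weight w2 (tfMon γ δ) = δ := by
  simp [weight_w2_apply, tfMon]

theorem tfMon_add (γ δ γ' δ' : ℕ) : tfMon γ δ + tfMon γ' δ' = tfMon (γ + γ') (δ + δ') := by
  rw [eq_tfMon_iff]
  simp [tfMon]

namespace HasCorner

variable {γ δ γ' δ' : ℕ} {c c' : k} {p q : MvPolynomial (Fin 6) k}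

theorem mem_Pset (h : HasCorner γ δ c p) (hc : c ≠ 0) : p ∈ Pset γ δ := by
  obtain ⟨hbox, rfl⟩ := h
  refine ⟨fun hp => hc (by simp [hp]), Finset.sup_le fun m hm => (hbox m hm).1,
    Finset.sup_le fun m hm => (hbox m hm).2, mem_support_iff.2 hc, fun m hm hne => ?_⟩
  obtain ⟨h1, h2⟩ := hbox m hm
  rw [weight_w1_apply] at h1
  rw [weight_w2_apply] at h2
  rw [Ne, eq_tfMon_iff] at hne
  by_cases h5 : m 5 < γ
  · left
    simpa [tfMon] using h5
  · have h0 : m 0 = 0 ∧ m 1 = 0 ∧ m 2 = 0 ∧ m 3 = 0 ∧ m 5 = γ := by omega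
    refine Or.inr ⟨by simpa [tfMon] using h0.2.2.2.2, 4, fun l hl => ?_, ?_⟩
    · fin_cases l <;> simp_all [tfMon]
    · have h4 : m 4 < δ := by omega
      simpa [tfMon] using h4

theorem add (hp : HasCorner γ δ c p) (hq : HasCorner γ δ c' q) :
    HasCorner γ δ (c + c') (p + q) := by
  classical
  refine ⟨fun m hm => ?_, by rw [coeff_add, hp.2, hq.2]⟩
  rcases Finset.mem_union.1 (support_add hm) with h | h
  exacts [hp.1 m h, hq.1 m h]

theorem mul (hp : HasCorner γ δ c p) (hq : HasCorner γ' δ' c' q) :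
    HasCorner (γ + γ') (δ + δ') (c * c') (p * q) := by
  classical
  constructor
  · intro m hm
    obtain ⟨a, ha, b, hb, rfl⟩ := Finset.mem_add.1 (support_mul p q hm)
    rw [map_add, map_add]
    exact ⟨add_le_add (hp.1 a ha).1 (hq.1 b hb).1, add_le_add (hp.1 a ha).2 (hq.1 b hb).2⟩
  · rw [coeff_mul, Finset.sum_eq_single (tfMon γ δ, tfMon γ' δ'), hp.2, hq.2]
    · rintro ⟨a, b⟩ hab hne
      by_contra hprod
      have ha := hp.1 a (mem_support_iff.2 (left_ne_zero_of_mul hprod))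
      have hb := hq.1 b (mem_support_iff.2 (right_ne_zero_of_mul hprod))
      rw [Finset.HasAntidiagonal.mem_antidiagonal, eq_tfMon_iff] at hab
      simp only [weight_w1_apply, weight_w2_apply, Finsupp.add_apply] at ha hb hab
      have ha' : a = tfMon γ δ := eq_tfMon_iff.2 (by omega)
      have hb' : b = tfMon γ' δ' := eq_tfMon_iff.2 (by omega)
      exact hne (by rw [ha', hb'])
    · intro h
      exact absurd (Finset.HasAntidiagonal.mem_antidiagonal.2 (tfMon_add γ δ γ' δ')) h

theorem pow (hp : HasCorner γ δ c p) (n : ℕ) : HasCorner (n * γ) (n * δ) (c ^ n) (p ^ n) := by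
  induction n with
  | zero =>
    refine ⟨fun m hm => ?_, by simp [tfMon]⟩
    have hm0 : m = 0 := by
      rw [pow_zero, mem_support_iff, coeff_one] at hm
      by_contra h
      exact hm (if_neg (Ne.symm h))
    simp [hm0]
  | succ n ih => simpa only [Nat.succ_mul, pow_succ] using ih.mul hp

theorem C_mul (a : k) (hp : HasCorner γ δ c p) : HasCorner γ δ (a * c) (C a * p) :=
  ⟨fun m hm => hp.1 m (mem_support_iff.2 fun h => mem_support_iff.1 hm (by simp [h])),
    by rw [coeff_C_mul, hp.2]⟩

theorem neg (hp : HasCorner γ δ c p) : HasCorner γ δ (-c) (-p) := by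
  simpa using hp.C_mul (-1)

theorem sub (hp : HasCorner γ δ c p) (hq : HasCorner γ δ c' q) :
    HasCorner γ δ (c - c') (p - q) := by
  simpa only [sub_eq_add_neg] using hp.add hq.neg

theorem cast (hp : HasCorner γ δ c p) (hγ : γ = γ') (hδ : δ = δ') (hc : c = c') :
    HasCorner γ' δ' c' p := by
  subst hγ hδ hc
  exact hp

/-- Enlarging the box strictly makes the corner coefficient vanish. -/
theorem enlarge (hp : HasCorner γ δ c p) (hγ : γ ≤ γ') (hδ : δ ≤ δ') (h : γ < γ' ∨ δ < δ') :
    HasCorner γ' δ' 0 p := by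
  refine ⟨fun m hm => ⟨(hp.1 m hm).1.trans hγ, (hp.1 m hm).2.trans hδ⟩, ?_⟩
  by_contra hne
  have := hp.1 _ (mem_support_iff.2 hne)
  rw [weight_w1_tfMon, weight_w2_tfMon] at this
  omega

theorem ofMonomial {m : Fin 6 →₀ ℕ} (a : k) (h1 : Finsupp.weight w1 m ≤ γ)
    (h2 : Finsupp.weight w2 m ≤ δ) (hm : m ≠ tfMon γ δ) : HasCorner γ δ 0 (monomial m a) := by
  classical
  refine ⟨fun n hn => ?_, by rw [coeff_monomial, if_neg hm]⟩
  rw [Finset.mem_singleton.1 (support_monomial_subset hn)]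
  exact ⟨h1, h2⟩

theorem monomial_tfMon (a : k) : HasCorner γ δ a (monomial (tfMon γ δ) a) := by
  classical
  refine ⟨fun n hn => ?_, by rw [coeff_monomial, if_pos rfl]⟩
  rw [Finset.mem_singleton.1 (support_monomial_subset hn), weight_w1_tfMon, weight_w2_tfMon]
  exact ⟨le_rfl, le_rfl⟩

end HasCorner

theorem hasCorner_C (a : k) : HasCorner 0 0 a (C a) := by
  simpa [tfMon] using HasCorner.monomial_tfMon (γ := 0) (δ := 0) a

theorem hasCorner_ofNat (n : ℕ) [n.AtLeastTwo] :
    HasCorner 0 0 (OfNat.ofNat n : k) (OfNat.ofNat n : MvPolynomial (Fin 6) k) := by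
  simpa only [map_ofNat] using hasCorner_C (OfNat.ofNat n : k)

theorem hasCorner_X0 : HasCorner 1 0 (0 : k) (X 0) :=
  .ofMonomial 1 (by simp [weight_w1_apply]) (by simp [weight_w2_apply]) (by simp [eq_tfMon_iff])

theorem hasCorner_X1 : HasCorner 2 0 (0 : k) (X 1) :=
  .ofMonomial 1 (by simp [weight_w1_apply]) (by simp [weight_w2_apply]) (by simp [eq_tfMon_iff])

theorem hasCorner_X2 : HasCorner 3 0 (0 : k) (X 2) :=
  .ofMonomial 1 (by simp [weight_w1_apply]) (by simp [weight_w2_apply]) (by simp [eq_tfMon_iff])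

theorem hasCorner_X3 : HasCorner 1 0 (0 : k) (X 3) :=
  .ofMonomial 1 (by simp [weight_w1_apply]) (by simp [weight_w2_apply]) (by simp [eq_tfMon_iff])

theorem hasCorner_X4 : HasCorner 0 1 (1 : k) (X 4) := by
  simpa [tfMon, X] using HasCorner.monomial_tfMon (γ := 0) (δ := 1) (1 : k)

theorem hasCorner_X5 : HasCorner 1 0 (1 : k) (X 5) := by
  simpa [tfMon, X] using HasCorner.monomial_tfMon (γ := 1) (δ := 0) (1 : k)

theorem pderiv_ofNat (i : Fin 6) (n : ℕ) [n.AtLeastTwo] :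
    pderiv i (ofNat(n) : MvPolynomial (Fin 6) k) = 0 :=
  (pderiv i).map_natCast n

theorem Del'_smul (a : k) (p : MvPolynomial (Fin 6) k) : Del' (a • p) = a • Del' p := by
  simp only [Del', Derivation.map_smul, smul_add, mul_smul_comm]

/-- The exponential of `u Δ'` at the start of a sequence of divided powers of `Δ'`. -/
theorem exp_apply_of_dividedPowers [CharZero k] {u : k}
    {φ' : MvPolynomial (Fin 6) k ≃ₐ[k] MvPolynomial (Fin 6) k}
    (hφ' : IsExpOf (fun p => u • Del' p) φ') (e : ℕ → MvPolynomial (Fin 6) k) (N : ℕ)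
    (he : ∀ i < N, Del' (e i) = ((i + 1 : ℕ) : k) • e (i + 1)) (hN : e N = 0) :
    φ' (e 0) = ∑ i ∈ Finset.range N, u ^ i • e i := by
  have key : ∀ i ≤ N, (fun p => u • Del' p)^[i] (e 0) = ((i.factorial : k) * u ^ i) • e i := by
    intro i
    induction i with
    | zero => simp
    | succ i ih =>
      intro hi
      rw [Function.iterate_succ_apply', ih (by omega)]
      simp only [Del'_smul, he i (by omega), smul_smul, Nat.factorial_succ]
      congr 1
      push_cast
      ring
  rw [hφ' (e 0) N (by rw [key N le_rfl, hN, smul_zero])]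
  refine Finset.sum_congr rfl fun i hi => ?_
  have hfac : (i.factorial : k) ≠ 0 := Nat.cast_ne_zero.2 i.factorial_ne_zero
  rw [key i (Finset.mem_range.1 hi).le, smul_smul, inv_mul_cancel_left₀ hfac]

section Exponential

variable {u : k} {φ' : MvPolynomial (Fin 6) k ≃ₐ[k] MvPolynomial (Fin 6) k}

theorem exp_X4 (hφ' : IsExpOf (fun p => u • Del' p) φ') : φ' (X 4) = X 4 := by
  rw [hφ' (X 4) 1 (by simp [Del', pderiv_X])]
  simp

theorem hasCorner_exp_X0 [CharZero k] (hφ' : IsExpOf (fun p => u • Del' p) φ') :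
    HasCorner 1 2 (u ^ 2) (φ' (X 0)) := by
  have h := exp_apply_of_dividedPowers hφ'
    (fun n => [X 0, -(2 * (X 3 * X 4)), X 4 ^ 2 * X 5].getD n 0) 3
    (fun i hi => by
      interval_cases i <;>
      · simp [Del', pderiv_X, Derivation.leibniz, pderiv_ofNat, Derivation.leibniz_pow,
          smul_eq_C_mul, map_ofNat]
        try ring)
    (by simp)
  simp only [Finset.sum_range_succ, Finset.sum_range_zero, List.getD_cons_zero,
    List.getD_cons_succ, smul_eq_C_mul, zero_add] at h
  rw [h]
  have h0 : HasCorner 1 2 (0 : k) (X 0) := hasCorner_X0.enlarge (by simp) (by simp) (by simp)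
  have h1 : HasCorner 1 2 (0 : k) (-(2 * (X 3 * X 4))) :=
    ((hasCorner_ofNat 2).mul (hasCorner_X3.mul hasCorner_X4)).neg.enlarge
      (by simp) (by simp) (by simp)
  have h2 : HasCorner 1 2 (1 : k) (X 4 ^ 2 * X 5) :=
    ((hasCorner_X4.pow 2).mul hasCorner_X5).cast (by simp) (by simp) (by simp)
  exact (((h0.C_mul _).add (h1.C_mul _)).add (h2.C_mul _)).cast rfl rfl (by simp)

theorem hasCorner_exp_X1 [CharZero k] (hφ' : IsExpOf (fun p => u • Del' p) φ') :
    HasCorner 2 3 (-u ^ 4) (φ' (X 1)) := by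
  have h := exp_apply_of_dividedPowers hφ'
    (fun n => [X 1, 4 * X 0 * X 3 - X 5, -(4 * X 3 ^ 2 * X 4) - 2 * X 0 * X 4 * X 5,
      4 * X 3 * X 4 ^ 2 * X 5, -(X 4 ^ 3 * X 5 ^ 2)].getD n 0) 5
    (fun i hi => by
      interval_cases i <;>
      · simp [Del', pderiv_X, Derivation.leibniz, pderiv_ofNat, Derivation.leibniz_pow,
          smul_eq_C_mul, map_ofNat]
        try ring)
    (by simp)
  simp only [Finset.sum_range_succ, Finset.sum_range_zero, List.getD_cons_zero,
    List.getD_cons_succ, smul_eq_C_mul, zero_add] at h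
  rw [h]
  have h0 : HasCorner 2 3 (0 : k) (X 1) := hasCorner_X1.enlarge (by simp) (by simp) (by simp)
  have h1 : HasCorner 2 3 (0 : k) (4 * X 0 * X 3 - X 5) :=
    ((((hasCorner_ofNat 4).mul hasCorner_X0).mul hasCorner_X3).enlarge
      (by simp) (by simp) (by simp)).sub (hasCorner_X5.enlarge (by simp) (by simp) (by simp))
      |>.cast rfl rfl (by simp)
  have h2 : HasCorner 2 3 (0 : k) (-(4 * X 3 ^ 2 * X 4) - 2 * X 0 * X 4 * X 5) :=
    ((((hasCorner_ofNat 4).mul (hasCorner_X3.pow 2)).mul hasCorner_X4).neg.enlarge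
      (by simp) (by simp) (by simp)).sub
      (((((hasCorner_ofNat 2).mul hasCorner_X0).mul hasCorner_X4).mul hasCorner_X5).enlarge
        (by simp) (by simp) (by simp)) |>.cast rfl rfl (by simp)
  have h3 : HasCorner 2 3 (0 : k) (4 * X 3 * X 4 ^ 2 * X 5) :=
    ((((hasCorner_ofNat 4).mul hasCorner_X3).mul (hasCorner_X4.pow 2)).mul hasCorner_X5).enlarge
      (by simp) (by simp) (by simp)
  have h4 : HasCorner 2 3 (-1 : k) (-(X 4 ^ 3 * X 5 ^ 2)) :=
    ((hasCorner_X4.pow 3).mul (hasCorner_X5.pow 2)).neg.cast (by simp) (by simp) (by simp)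
  exact (((((h0.C_mul _).add (h1.C_mul _)).add (h2.C_mul _)).add (h3.C_mul _)).add
    (h4.C_mul _)).cast rfl rfl (by simp)

theorem hasCorner_exp_X2 [CharZero k] (hφ' : IsExpOf (fun p => u • Del' p) φ') :
    HasCorner 3 4 (u ^ 6) (φ' (X 2)) := by
  have h := exp_apply_of_dividedPowers hφ'
    (fun n => [X 2, 6 * X 1 * X 3 + 2 * X 4 ^ 2,
      12 * X 0 * X 3 ^ 2 - 3 * X 3 * X 5 - 3 * X 1 * X 4 * X 5,
      2 * X 4 * X 5 ^ 2 - 8 * X 3 ^ 3 * X 4 - 12 * X 0 * X 3 * X 4 * X 5,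
      12 * X 3 ^ 2 * X 4 ^ 2 * X 5 + 3 * X 0 * X 4 ^ 2 * X 5 ^ 2,
      -(6 * X 3 * X 4 ^ 3 * X 5 ^ 2), X 4 ^ 4 * X 5 ^ 3].getD n 0) 7
    (fun i hi => by
      interval_cases i <;>
      · simp [Del', pderiv_X, Derivation.leibniz, pderiv_ofNat, Derivation.leibniz_pow,
          smul_eq_C_mul, map_ofNat]
        try ring)
    (by simp)
  simp only [Finset.sum_range_succ, Finset.sum_range_zero, List.getD_cons_zero,
    List.getD_cons_succ, smul_eq_C_mul, zero_add] at h
  rw [h]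
  have h0 : HasCorner 3 4 (0 : k) (X 2) := hasCorner_X2.enlarge (by simp) (by simp) (by simp)
  have h1 : HasCorner 3 4 (0 : k) (6 * X 1 * X 3 + 2 * X 4 ^ 2) :=
    ((((hasCorner_ofNat 6).mul hasCorner_X1).mul hasCorner_X3).enlarge
      (by simp) (by simp) (by simp)).add
      (((hasCorner_ofNat 2).mul (hasCorner_X4.pow 2)).enlarge (by simp) (by simp) (by simp))
      |>.cast rfl rfl (by simp)
  have h2 : HasCorner 3 4 (0 : k)
      (12 * X 0 * X 3 ^ 2 - 3 * X 3 * X 5 - 3 * X 1 * X 4 * X 5) :=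
    (((((hasCorner_ofNat 12).mul hasCorner_X0).mul (hasCorner_X3.pow 2)).enlarge
      (by simp) (by simp) (by simp)).sub
      ((((hasCorner_ofNat 3).mul hasCorner_X3).mul hasCorner_X5).enlarge
        (by simp) (by simp) (by simp))).sub
      (((((hasCorner_ofNat 3).mul hasCorner_X1).mul hasCorner_X4).mul hasCorner_X5).enlarge
        (by simp) (by simp) (by simp)) |>.cast rfl rfl (by simp)
  have h3 : HasCorner 3 4 (0 : k)
      (2 * X 4 * X 5 ^ 2 - 8 * X 3 ^ 3 * X 4 - 12 * X 0 * X 3 * X 4 * X 5) :=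
    (((((hasCorner_ofNat 2).mul hasCorner_X4).mul (hasCorner_X5.pow 2)).enlarge
      (by simp) (by simp) (by simp)).sub
      ((((hasCorner_ofNat 8).mul (hasCorner_X3.pow 3)).mul hasCorner_X4).enlarge
        (by simp) (by simp) (by simp))).sub
      ((((((hasCorner_ofNat 12).mul hasCorner_X0).mul hasCorner_X3).mul hasCorner_X4).mul
        hasCorner_X5).enlarge (by simp) (by simp) (by simp)) |>.cast rfl rfl (by simp)
  have h4 : HasCorner 3 4 (0 : k)
      (12 * X 3 ^ 2 * X 4 ^ 2 * X 5 + 3 * X 0 * X 4 ^ 2 * X 5 ^ 2) :=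
    (((((hasCorner_ofNat 12).mul (hasCorner_X3.pow 2)).mul (hasCorner_X4.pow 2)).mul
      hasCorner_X5).enlarge (by simp) (by simp) (by simp)).add
      (((((hasCorner_ofNat 3).mul hasCorner_X0).mul (hasCorner_X4.pow 2)).mul
        (hasCorner_X5.pow 2)).enlarge (by simp) (by simp) (by simp)) |>.cast rfl rfl (by simp)
  have h5 : HasCorner 3 4 (0 : k) (-(6 * X 3 * X 4 ^ 3 * X 5 ^ 2)) :=
    ((((hasCorner_ofNat 6).mul hasCorner_X3).mul (hasCorner_X4.pow 3)).mul
      (hasCorner_X5.pow 2)).neg.enlarge (by simp) (by simp) (by simp)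
  have h6 : HasCorner 3 4 (1 : k) (X 4 ^ 4 * X 5 ^ 3) :=
    ((hasCorner_X4.pow 4).mul (hasCorner_X5.pow 3)).cast (by simp) (by simp) (by simp)
  exact (((((((h0.C_mul _).add (h1.C_mul _)).add (h2.C_mul _)).add (h3.C_mul _)).add
    (h4.C_mul _)).add (h5.C_mul _)).add (h6.C_mul _)).cast rfl rfl (by simp)

end Exponential

/-- A type-`γ` affine combination of elements in the nested boxes `(i + 1, i + 2)` lies in the
box `(γ, γ + 1)`, with nonzero corner coefficient. -/
theorem HasCorner.affine {s : Fin 3 → k} {Y : Fin 3 → MvPolynomial (Fin 6) k}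
    (hY : ∀ i : Fin 3, HasCorner ((i : ℕ) + 1) ((i : ℕ) + 2) (s i) (Y i)) (hs : ∀ i, s i ≠ 0)
    {A : Matrix (Fin 3) (Fin 3) k} {j : Fin 3} {γ : ℕ} (hγ : TypeIs A j γ) (b : k) :
    ∃ c ≠ 0, HasCorner γ (γ + 1) c ((∑ i, C (A i j) * Y i) + C b) := by
  obtain ⟨i, rfl, hi, hlast⟩ := hγ
  have hterm : ∀ l, HasCorner ((i : ℕ) + 1) ((i : ℕ) + 2) (if l = i then A i j * s i else 0)
      (C (A l j) * Y l) := by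
    intro l
    rcases lt_trichotomy l i with h | rfl | h
    · rw [if_neg h.ne]
      exact ((hY l).C_mul _).enlarge (by omega) (by omega) (by omega)
    · rw [if_pos rfl]
      exact (hY l).C_mul _
    · rw [if_neg h.ne', hlast l h]
      simpa using (hY i).C_mul 0
  refine ⟨A i j * s i, mul_ne_zero hi (hs i), ?_⟩
  rw [Fin.sum_univ_three]
  refine ((((hterm 0).add (hterm 1)).add (hterm 2)).add
    ((hasCorner_C b).enlarge (by omega) (by omega) (by omega))).cast rfl rfl ?_
  fin_cases i <;> simp

/-- (Lemma 3 of the paper.)  If the type of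
`α ∈ Aff_3(k) \ B` satisfies `(γ1,γ3) = (3,3)` and `γ2 ≤ 2`, or
`(γ1,γ3) ≠ (3,3)` and `γ2 = 3`, then the lift `α̂` satisfies condition (C). -/
theorem statement15 [CharZero k]
    (hln6 : ∀ p : MvPolynomial (Fin 6) k, ∃ l : ℕ, Del'^[l] p = 0)
    (u : k) (hu : u ≠ 0)
    (φ' : MvPolynomial (Fin 6) k ≃ₐ[k] MvPolynomial (Fin 6) k)
    (hφ' : IsExpOf (fun p => u • Del' p) φ')
    (α : MvPolynomial (Fin 3) k ≃ₐ[k] MvPolynomial (Fin 3) k)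
    (A : Matrix (Fin 3) (Fin 3) k) (d : Fin 3 → k)
    (hdet : IsUnit A.det)
    (hαA : ∀ i : Fin 3, α (X i) = (∑ j : Fin 3, C (A j i) * X j) + C (d i))
    (hαB : α ∉ BSet)
    (γ1 γ2 γ3 : ℕ)
    (ht1 : TypeIs A 0 γ1) (ht2 : TypeIs A 1 γ2) (ht3 : TypeIs A 2 γ3)
    (hcase : ((γ1 = 3 ∧ γ3 = 3) ∧ γ2 ≤ 2) ∨ (¬ (γ1 = 3 ∧ γ3 = 3) ∧ γ2 = 3)) :
    CondC γ1 γ2 γ3 φ' (hatLift A d) := by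
  have hC : ∀ a : k, φ' (C a) = C a := φ'.commutes
  let Y : Fin 3 → MvPolynomial (Fin 6) k := fun i => φ' (X (ι36 i))
  have hY : ∀ i : Fin 3,
      HasCorner ((i : ℕ) + 1) ((i : ℕ) + 2) (![u ^ 2, -u ^ 4, u ^ 6] i) (Y i) := by
    intro i
    fin_cases i
    exacts [hasCorner_exp_X0 hφ', hasCorner_exp_X1 hφ', hasCorner_exp_X2 hφ']
  have hs : ∀ i, ![u ^ 2, -u ^ 4, u ^ 6] i ≠ 0 := by
    intro i
    fin_cases i <;> simp [hu]
  have hZ : ∀ j, φ' (affImg A d j) = (∑ i, C (A i j) * Y i) + C (d j) := by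
    intro j
    simp [affImg, hC, Y]
  obtain ⟨c1, hc1, h1⟩ := HasCorner.affine hY hs ht1 (d 0)
  obtain ⟨c2, hc2, h2⟩ := HasCorner.affine hY hs ht2 (d 1)
  obtain ⟨c3, hc3, h3⟩ := HasCorner.affine hY hs ht3 (d 2)
  rw [← hZ] at h1 h2 h3
  have hrange : (1 ≤ γ1 ∧ γ1 ≤ 3) ∧ (1 ≤ γ2 ∧ γ2 ≤ 3) ∧ 1 ≤ γ3 ∧ γ3 ≤ 3 := by
    obtain ⟨i1, rfl, -⟩ := ht1
    obtain ⟨i2, rfl, -⟩ := ht2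
    obtain ⟨i3, rfl, -⟩ := ht3
    omega
  obtain ⟨t, ht, hT⟩ : ∃ t ≠ 0, HasCorner 6 8 t (φ' (hatTf A d)) := by
    have hrel : HasCorner 6 8 (0 : k) (C (A 0 0 * A 2 2 - 2 * (A 0 1 * A 2 1) + A 0 2 * A 2 0) *
        (X 4 - (Y 0 * Y 2 - Y 1 ^ 2))) :=
      (((hasCorner_X4.enlarge (by omega) (by omega) (by omega)).sub
        ((((hY 0).mul (hY 2)).enlarge (by simp) (by simp) (by simp)).sub
        (((hY 1).pow 2).enlarge (by simp) (by simp) (by simp)))).C_mul _).cast rfl rfl (by simp)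
    have hexp : φ' (hatTf A d) = φ' (affImg A d 0) * φ' (affImg A d 2) - φ' (affImg A d 1) ^ 2 +
        C (A 0 0 * A 2 2 - 2 * (A 0 1 * A 2 1) + A 0 2 * A 2 0) *
          (X 4 - (Y 0 * Y 2 - Y 1 ^ 2)) := by
      rw [hatTf, map_add, map_mul φ' (C _), hC]
      simp only [map_sub, map_mul, map_pow, exp_X4 hφ']
      rfl
    rw [hexp]
    rcases hcase with ⟨⟨rfl, rfl⟩, h⟩ | ⟨h, rfl⟩
    · exact ⟨c1 * c3, mul_ne_zero hc1 hc3, (((h1.mul h3).sub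
        ((h2.pow 2).enlarge (by omega) (by omega) (by omega))).add hrel).cast rfl rfl (by simp)⟩
    · exact ⟨-c2 ^ 2, neg_ne_zero.2 (pow_ne_zero 2 hc2),
        ((((h1.mul h3).enlarge (by omega) (by omega) (by omega)).sub (h2.pow 2)).add
          hrel).cast rfl rfl (by simp)⟩
  have hR : HasCorner (γ2 + 6) (γ2 + 9) (c2 * t) (φ' (hatLift A d (X 3))) := by
    have hX : hatLift A d (X 3) = affImg A d 1 * hatTf A d + affImg A d 0 ^ 2 := by
      simp [hatLift]
    rw [hX, map_add, map_mul, map_pow]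
    exact ((h2.mul hT).cast rfl (by omega) rfl).add
      ((h1.pow 2).enlarge (by omega) (by omega) (by omega)) |>.cast rfl rfl (by simp)
  have hG : HasCorner (γ3 + 12) (γ3 + 17) (c3 * t ^ 2) (φ' (hatLift A d (X 5))) := by
    have hX : hatLift A d (X 5) = affImg A d 2 * hatTf A d ^ 2 +
        2 * affImg A d 0 * affImg A d 1 * hatTf A d + affImg A d 0 ^ 3 := by
      simp [hatLift]
    rw [hX]
    simp only [map_add, map_mul, map_pow, map_ofNat]
    exact (((h3.mul (hT.pow 2)).cast rfl (by omega) rfl).add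
      (((((hasCorner_ofNat 2).mul h1).mul h2).mul hT).enlarge
        (by omega) (by omega) (by omega))).add
      ((h1.pow 3).enlarge (by omega) (by omega) (by omega)) |>.cast rfl rfl (by simp)
  have hF : φ' (hatLift A d (X 4)) = φ' (hatTf A d) := by simp [hatLift]
  refine ⟨γ2 + 6, 6, γ3 + 12, γ2 + 9, 8, γ3 + 17, by omega, by omega, by omega,
    hR.mem_Pset (mul_ne_zero hc2 ht), hF ▸ hT.mem_Pset ht,
    hG.mem_Pset (mul_ne_zero hc3 (pow_ne_zero 2 ht)), ?_⟩
  omega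

end YasudaPaper
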